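/- Consider the weighted ℓ¹-norm ‖x‖_{w1}^{(d)} = ∑_{i=1}^d i |x^i| on ℝ^d and let N_{w1}^{(d)}(k) = #{x ∈ ℤ^d : ‖x‖_{w1}^{(d)} = k}. Define a^{(d)} recursively by a^{(1)} = 2 and a^{(d)} = (2/(d(d−1))) a^{(d−1)} for d ≥ 2. Then for every d ≥ 2 there exists a positive constant b^{(d)} such that |N_{w1}^{(d)}(k) − a^{(d)} k^{d−1}| ≤ b^{(d)} k^{d−2} for every integer k ≥ 1; in particular N_{w1}^{(d)}(k) / k^{d−1} → a^{(d)} as k → ∞. -/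

import Mathlib

open Filter
open scoped Topology

/-- The lattice points of `ℤ^d` whose weighted `ℓ¹`-norm `∑ i·|x^i|` equals `k`. -/
def weightedSphere (d k : ℕ) : Set (Fin d → ℤ) :=
  {x | (∑ i, (i.val + 1) * (x i).natAbs) = k}

lemma finite_weightedSphere (d k : ℕ) : (weightedSphere d k).Finite := by
  refine (Set.finite_Icc (fun _ : Fin d => -(k : ℤ)) (fun _ => (k : ℤ))).subset fun x hx => ?_
  have hle (i : Fin d) : (x i).natAbs ≤ k := by
    calc (x i).natAbs ≤ (i.val + 1) * (x i).natAbs := Nat.le_mul_of_pos_left _ (by lia)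
      _ ≤ ∑ i : Fin d, (i.val + 1) * (x i).natAbs :=
        Finset.single_le_sum (f := fun i : Fin d => (i.val + 1) * (x i).natAbs)
          (fun _ _ => Nat.zero_le _) (Finset.mem_univ i)
      _ = k := hx
  exact ⟨fun i => by have := hle i; simp only; lia, fun i => by have := hle i; simp only; lia⟩

lemma snoc_mem_weightedSphere {d k : ℕ} (y : Fin d → ℤ) (z : ℤ) :
    (Fin.snoc y z : Fin (d + 1) → ℤ) ∈ weightedSphere (d + 1) k ↔
      (∑ i, (i.val + 1) * (y i).natAbs) + (d + 1) * z.natAbs = k := by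
  simp [weightedSphere, Fin.sum_univ_castSucc]

/-- Moving an integer one step away from zero, with zero moving to one. -/
def moveAway (z : ℤ) : ℤ := if 0 ≤ z then z + 1 else z - 1

lemma moveAway_injective : Function.Injective moveAway := fun a b h => by
  unfold moveAway at h
  split_ifs at h <;> lia

lemma natAbs_moveAway (z : ℤ) : (moveAway z).natAbs = z.natAbs + 1 := by
  unfold moveAway
  split_ifs <;> lia

lemma exists_moveAway_eq {z : ℤ} (h0 : z ≠ 0) (h1 : z ≠ -1) : ∃ w, moveAway w = z := by
  refine ⟨if 0 < z then z - 1 else z + 1, ?_⟩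
  unfold moveAway
  split_ifs <;> lia

lemma moveAway_ne_zero (z : ℤ) : moveAway z ≠ 0 := by
  unfold moveAway
  split_ifs <;> lia

lemma moveAway_ne_neg_one (z : ℤ) : moveAway z ≠ -1 := by
  unfold moveAway
  split_ifs <;> lia

lemma snoc_left_injective {d : ℕ} (z : ℤ) :
    Function.Injective fun y : Fin d → ℤ => (Fin.snoc y z : Fin (d + 1) → ℤ) :=
  fun _ _ h => (Fin.snoc_inj.1 h).1

lemma snoc_moveAway_injective {d : ℕ} :
    Function.Injective fun x : Fin (d + 1) → ℤ =>
      (Fin.snoc (Fin.init x) (moveAway (x (Fin.last d))) : Fin (d + 1) → ℤ) := by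
  intro x y h
  obtain ⟨h1, h2⟩ := Fin.snoc_inj.1 h
  rw [← Fin.snoc_init_self x, ← Fin.snoc_init_self y, h1, moveAway_injective h2]

lemma weightedSphere_succ_add (d k : ℕ) :
    weightedSphere (d + 1) (k + (d + 1)) =
      ((fun y : Fin d → ℤ => (Fin.snoc y 0 : Fin (d + 1) → ℤ)) '' weightedSphere d (k + (d + 1)) ∪
        (fun y : Fin d → ℤ => (Fin.snoc y (-1) : Fin (d + 1) → ℤ)) '' weightedSphere d k) ∪
      (fun x : Fin (d + 1) → ℤ =>
        (Fin.snoc (Fin.init x) (moveAway (x (Fin.last d))) : Fin (d + 1) → ℤ)) ''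
          weightedSphere (d + 1) k := by
  ext x
  induction x using Fin.snocCases with | _ y z
  rw [snoc_mem_weightedSphere]
  constructor
  · intro h
    by_cases h0 : z = 0
    · subst h0
      exact Or.inl (Or.inl ⟨y, by simpa [weightedSphere] using h, rfl⟩)
    by_cases h1 : z = -1
    · subst h1
      exact Or.inl (Or.inr ⟨y, by simpa [weightedSphere] using h, rfl⟩)
    obtain ⟨w, rfl⟩ := exists_moveAway_eq h0 h1
    refine Or.inr ⟨Fin.snoc y w, ?_, by simp⟩
    rw [snoc_mem_weightedSphere]
    rw [natAbs_moveAway] at h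
    lia
  · rintro ((⟨y', hy, h⟩ | ⟨y', hy, h⟩) | ⟨x, hx, h⟩)
    · obtain ⟨rfl, rfl⟩ := Fin.snoc_inj.1 h
      simpa [weightedSphere] using hy
    · obtain ⟨rfl, rfl⟩ := Fin.snoc_inj.1 h
      simpa [weightedSphere] using hy
    · obtain ⟨rfl, rfl⟩ := Fin.snoc_inj.1 h
      rw [← Fin.snoc_init_self x, snoc_mem_weightedSphere] at hx
      rw [natAbs_moveAway]
      lia

lemma ncard_weightedSphere_succ_add (d k : ℕ) :
    (weightedSphere (d + 1) (k + (d + 1))).ncard =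
      (weightedSphere d (k + (d + 1))).ncard + (weightedSphere d k).ncard +
        (weightedSphere (d + 1) k).ncard := by
  have hfin := finite_weightedSphere
  rw [weightedSphere_succ_add, Set.ncard_union_eq _ (((hfin _ _).image _).union ((hfin _ _).image _))
      ((hfin _ _).image _), Set.ncard_union_eq _ ((hfin _ _).image _) ((hfin _ _).image _),
    Set.ncard_image_of_injective _ (snoc_left_injective 0),
    Set.ncard_image_of_injective _ (snoc_left_injective (-1)),
    Set.ncard_image_of_injective _ snoc_moveAway_injective]
  · rw [Set.disjoint_left]
    rintro _ ⟨y, -, rfl⟩ ⟨y', -, h⟩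
    exact absurd (Fin.snoc_inj.1 h).2 (by norm_num)
  · rw [Set.disjoint_left]
    rintro _ (⟨y, -, rfl⟩ | ⟨y, -, rfl⟩) ⟨x, -, h⟩
    · exact moveAway_ne_zero _ (Fin.snoc_inj.1 h).2
    · exact moveAway_ne_neg_one _ (Fin.snoc_inj.1 h).2

lemma ncard_weightedSphere_succ_of_le {d k : ℕ} (hk : k ≤ d) :
    (weightedSphere (d + 1) k).ncard = (weightedSphere d k).ncard := by
  rw [← Set.ncard_image_of_injective (weightedSphere d k) (snoc_left_injective 0)]
  congr 1
  ext x
  induction x using Fin.snocCases with | _ y z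
  rw [snoc_mem_weightedSphere]
  constructor
  · intro h
    have hz : z = 0 := by
      by_contra hz
      have : (d + 1) * 1 ≤ (d + 1) * z.natAbs := Nat.mul_le_mul_left _ (by lia)
      lia
    subst hz
    exact ⟨y, by simpa [weightedSphere] using h, rfl⟩
  · rintro ⟨y', hy, h⟩
    obtain ⟨rfl, rfl⟩ := Fin.snoc_inj.1 h
    simpa [weightedSphere] using hy

lemma ncard_weightedSphere_zero_zero : (weightedSphere 0 0).ncard = 1 := by
  simp [weightedSphere, Set.ncard_univ]

lemma ncard_weightedSphere_zero_succ (k : ℕ) : (weightedSphere 0 (k + 1)).ncard = 0 := by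
  simp [weightedSphere]

lemma ncard_weightedSphere_one_zero : (weightedSphere 1 0).ncard = 1 := by
  rw [ncard_weightedSphere_succ_of_le le_rfl, ncard_weightedSphere_zero_zero]

lemma ncard_weightedSphere_one_succ (k : ℕ) : (weightedSphere 1 (k + 1)).ncard = 2 := by
  have h := ncard_weightedSphere_succ_add 0
  simp only [zero_add, ncard_weightedSphere_zero_succ] at h
  induction k with
  | zero => rw [h, ncard_weightedSphere_zero_zero, ncard_weightedSphere_one_zero]
  | succ k ih => rw [h, ncard_weightedSphere_zero_succ, ih]

/-- The trapezoidal rule for `x ^ m` on an interval of length `h` is off by at most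
the oscillation of `x ^ m`. -/
lemma abs_trapezoid_pow_le (m : ℕ) {x h : ℝ} (hx : 0 ≤ x) (hh : 0 < h) :
    |(x + h) ^ m + x ^ m - 2 / (h * (m + 1)) * ((x + h) ^ (m + 1) - x ^ (m + 1))| ≤
      (x + h) ^ m - x ^ m := by
  have hgeom := (Commute.all (x + h) x).mul_geom_sum₂ (m + 1)
  set s := ∑ i ∈ Finset.range (m + 1), (x + h) ^ i * x ^ (m + 1 - 1 - i) with hs
  have hxh : x ≤ x + h := by linarith
  have hlow : (m + 1) * x ^ m ≤ s := by
    have := Finset.card_nsmul_le_sum (Finset.range (m + 1))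
      (fun i => (x + h) ^ i * x ^ (m + 1 - 1 - i)) (x ^ m) fun i hi => by
        have hi' : i + (m + 1 - 1 - i) = m := by have := Finset.mem_range.1 hi; lia
        calc x ^ m = x ^ i * x ^ (m + 1 - 1 - i) := by rw [← pow_add, hi']
          _ ≤ _ := by gcongr
    simpa [hs] using this
  have hupp : s ≤ (m + 1) * (x + h) ^ m := by
    have := Finset.sum_le_card_nsmul (Finset.range (m + 1))
      (fun i => (x + h) ^ i * x ^ (m + 1 - 1 - i)) ((x + h) ^ m) fun i hi => by
        have hi' : i + (m + 1 - 1 - i) = m := by have := Finset.mem_range.1 hi; lia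
        calc (x + h) ^ i * x ^ (m + 1 - 1 - i)
            ≤ (x + h) ^ i * (x + h) ^ (m + 1 - 1 - i) := by gcongr
          _ = (x + h) ^ m := by rw [← pow_add, hi']
    simpa [hs] using this
  have hm : (0 : ℝ) < m + 1 := by positivity
  have heq : 2 / (h * (m + 1)) * ((x + h) ^ (m + 1) - x ^ (m + 1)) = 2 * (s / (m + 1)) := by
    rw [← hgeom]
    field_simp
    ring
  rw [heq]
  have h1 : x ^ m ≤ s / (m + 1) := by rw [le_div_iff₀ hm]; linarith
  have h2 : s / (m + 1) ≤ (x + h) ^ m := by rw [div_le_iff₀ hm]; linarith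
  rw [abs_le]
  constructor <;> linarith

/-- If `f` and `g` are related as consecutive weighted sphere counts with new weight `n = m + 2`,
then the error of `g` is controlled by the accumulated error of `f`. -/
lemma abs_error_le_of_recurrence (m : ℕ) {f g : ℕ → ℝ} {α β : ℝ} (hα : 0 ≤ α)
    (hβ : β = 2 / (((m : ℝ) + 2) * (m + 1)) * α)
    (hbase : ∀ k < m + 2, g k = f k)
    (hrec : ∀ k, g (k + (m + 2)) = f (k + (m + 2)) + f k + g k) (k : ℕ) :
    |g k - β * (k : ℝ) ^ (m + 1)| ≤
      2 * ∑ j ∈ Finset.range (k + 1), |f j - α * (j : ℝ) ^ m| + 2 * α * (k : ℝ) ^ m := by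
  set e : ℕ → ℝ := fun j => |f j - α * (j : ℝ) ^ m| with he
  have he0 (j : ℕ) : 0 ≤ e j := abs_nonneg _
  have hS0 (k : ℕ) : 0 ≤ ∑ j ∈ Finset.range k, e j := Finset.sum_nonneg fun j _ => he0 j
  suffices h : |g k - β * (k : ℝ) ^ (m + 1)| ≤
      e k + 2 * ∑ j ∈ Finset.range k, e j + 2 * α * (k : ℝ) ^ m by
    rw [Finset.sum_range_succ]
    linarith [he0 k]
  suffices h : |(g k - β * (k : ℝ) ^ (m + 1)) - (f k - α * (k : ℝ) ^ m)| ≤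
      2 * ∑ j ∈ Finset.range k, e j + 2 * α * (k : ℝ) ^ m by
    have := abs_sub_abs_le_abs_sub (g k - β * (k : ℝ) ^ (m + 1)) (f k - α * (k : ℝ) ^ m)
    simp only [he] at *
    linarith
  induction k using Nat.strong_induction_on with
  | _ k ih =>
    by_cases hk : k < m + 2
    · rw [hbase k hk]
      have hk' : (k : ℝ) ≤ m + 2 := by exact_mod_cast hk.le
      have hp : 0 ≤ α * (k : ℝ) ^ m := by positivity
      have hβk : β * (k : ℝ) ^ (m + 1) = 2 * (k / (m + 2) / (m + 1)) * (α * (k : ℝ) ^ m) := by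
        rw [hβ]
        field_simp
        ring
      have hq0 : (0 : ℝ) ≤ k / (m + 2) / (m + 1) := by positivity
      have hq1 : (k : ℝ) / (m + 2) / (m + 1) ≤ 1 := by
        rw [div_div, div_le_one (by positivity)]
        nlinarith [(Nat.cast_nonneg m : (0 : ℝ) ≤ m)]
      rw [hβk, abs_le]
      constructor <;> nlinarith [hS0 k, mul_nonneg hq0 hp, mul_le_mul_of_nonneg_right hq1 hp]
    · obtain ⟨l, rfl⟩ : ∃ l, k = l + (m + 2) := ⟨k - (m + 2), by lia⟩
      have hl := ih l (by lia)
      have hsum : ∑ j ∈ Finset.range l, e j + e l ≤ ∑ j ∈ Finset.range (l + (m + 2)), e j := by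
        rw [← Finset.sum_range_succ]
        exact Finset.sum_le_sum_of_subset_of_nonneg
          (Finset.range_mono (by lia)) fun j _ _ => he0 j
      have htrap := mul_le_mul_of_nonneg_left
        (abs_trapezoid_pow_le m (Nat.cast_nonneg l) (by positivity : (0 : ℝ) < m + 2)) hα
      set r : ℝ := ((l : ℝ) + (m + 2)) ^ m + (l : ℝ) ^ m -
        2 / (((m : ℝ) + 2) * (m + 1)) * (((l : ℝ) + (m + 2)) ^ (m + 1) - (l : ℝ) ^ (m + 1)) with hr
      have hmono : (l : ℝ) ^ m ≤ ((l : ℝ) + (m + 2)) ^ m := by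
        gcongr
        linarith [(Nat.cast_nonneg m : (0 : ℝ) ≤ m)]
      have hdecomp : (g (l + (m + 2)) - β * ((l + (m + 2) : ℕ) : ℝ) ^ (m + 1)) -
          (f (l + (m + 2)) - α * ((l + (m + 2) : ℕ) : ℝ) ^ m) =
          ((g l - β * (l : ℝ) ^ (m + 1)) - (f l - α * (l : ℝ) ^ m)) +
            (2 * (f l - α * (l : ℝ) ^ m) + α * r) := by
        rw [hrec, hβ, hr]
        push_cast
        ring
      have habs2 : |2 * (f l - α * (l : ℝ) ^ m)| = 2 * e l := by
        rw [abs_mul, abs_two]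
      have habsr : |α * r| = α * |r| := by rw [abs_mul, abs_of_nonneg hα]
      rw [hdecomp]
      have t1 := abs_add_le ((g l - β * (l : ℝ) ^ (m + 1)) - (f l - α * (l : ℝ) ^ m))
        (2 * (f l - α * (l : ℝ) ^ m) + α * r)
      have t2 := abs_add_le (2 * (f l - α * (l : ℝ) ^ m)) (α * r)
      push_cast
      nlinarith [mul_le_mul_of_nonneg_left hmono hα]

/-- The sphere counts in dimension `d = m + 2` agree with `a d * k ^ (d - 1)` up to an error of
order `(k + 1) ^ (d - 2)`. -/
lemma exists_abs_error_le {a : ℕ → ℝ} (ha1 : a 1 = 2)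
    (har : ∀ d : ℕ, 2 ≤ d → a d = 2 / ((d : ℝ) * ((d : ℝ) - 1)) * a (d - 1)) (m : ℕ) :
    ∃ C : ℝ, 0 < C ∧ ∀ k : ℕ,
      |((weightedSphere (m + 2) k).ncard : ℝ) - a (m + 2) * (k : ℝ) ^ (m + 1)| ≤
        C * ((k : ℝ) + 1) ^ m := by
  have har' (m : ℕ) : a (m + 2) = 2 / (((m : ℝ) + 2) * (m + 1)) * a (m + 1) := by
    rw [har (m + 2) (by lia), show m + 2 - 1 = m + 1 by lia]
    push_cast
    ring_nf
  have hpos (m : ℕ) : 0 < a (m + 1) := by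
    induction m with
    | zero => simp [ha1]
    | succ m ih => rw [har' m]; positivity
  have hstep (m : ℕ) (B : ℝ) (hB0 : 0 < B)
      (hB : ∀ k : ℕ, ∑ j ∈ Finset.range (k + 1),
        |((weightedSphere (m + 1) j).ncard : ℝ) - a (m + 1) * (j : ℝ) ^ m| ≤
          B * ((k : ℝ) + 1) ^ m) :
      ∃ C : ℝ, 0 < C ∧ ∀ k : ℕ,
        |((weightedSphere (m + 2) k).ncard : ℝ) - a (m + 2) * (k : ℝ) ^ (m + 1)| ≤
          C * ((k : ℝ) + 1) ^ m := by
    refine ⟨2 * B + 2 * a (m + 1), by linarith [hpos m], fun k => ?_⟩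
    have h := abs_error_le_of_recurrence m
      (f := fun k => ((weightedSphere (m + 1) k).ncard : ℝ))
      (g := fun k => ((weightedSphere (m + 2) k).ncard : ℝ)) (hpos m).le (har' m)
      (fun k hk => by simp only [ncard_weightedSphere_succ_of_le (Nat.lt_succ_iff.1 hk)])
      (fun k => by exact_mod_cast ncard_weightedSphere_succ_add (m + 1) k) k
    have hk : (k : ℝ) ^ m ≤ ((k : ℝ) + 1) ^ m := by gcongr; linarith
    nlinarith [hB k, mul_le_mul_of_nonneg_left hk (hpos m).le]
  induction m with
  | zero =>
    refine hstep 0 1 one_pos fun k => ?_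
    rw [Finset.sum_range_succ', zero_add]
    norm_num [ncard_weightedSphere_one_succ, ncard_weightedSphere_one_zero, ha1]
  | succ m ih =>
    obtain ⟨C, hC0, hC⟩ := ih
    refine hstep (m + 1) C hC0 fun k => ?_
    calc _ ≤ ∑ _j ∈ Finset.range (k + 1), C * ((k : ℝ) + 1) ^ m := by
          refine Finset.sum_le_sum fun j hj => (hC j).trans ?_
          have : (j : ℝ) ≤ k := by exact_mod_cast Nat.lt_succ_iff.1 (Finset.mem_range.1 hj)
          gcongr
      _ = C * ((k : ℝ) + 1) ^ (m + 1) := by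
          rw [Finset.sum_const, Finset.card_range, nsmul_eq_mul]
          push_cast
          ring

/-- **Asymptotics of the weighted ℓ¹ sphere counts.** Let
`N^{(d)}(k) = #{x ∈ ℤ^d : ∑_i i·|x^i| = k}` and let `a` satisfy `a(1) = 2` and
`a(d) = (2/(d(d-1))) a(d-1)` for `d ≥ 2`. Then for every `d ≥ 2` there is `b > 0`
with `|N^{(d)}(k) - a(d) k^{d-1}| ≤ b k^{d-2}` for all `k ≥ 1`; in particular
`N^{(d)}(k)/k^{d-1} → a(d)` as `k → ∞`. -/
theorem stmt19
    (N : (d : ℕ) → ℕ → ℕ)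
    (hN : ∀ (d : ℕ) (k : ℕ), N d k =
      Set.ncard {x : Fin d → ℤ | (∑ i, (i.val + 1) * (x i).natAbs) = k})
    (a : ℕ → ℝ)
    (ha1 : a 1 = 2)
    (har : ∀ d : ℕ, 2 ≤ d → a d = 2 / ((d : ℝ) * ((d : ℝ) - 1)) * a (d - 1)) :
    ∀ d : ℕ, 2 ≤ d →
      (∃ b : ℝ, 0 < b ∧ ∀ k : ℕ, 1 ≤ k →
        |(N d k : ℝ) - a d * (k : ℝ) ^ (d - 1)| ≤ b * (k : ℝ) ^ (d - 2)) ∧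
      Tendsto (fun k : ℕ => (N d k : ℝ) / (k : ℝ) ^ (d - 1)) atTop (𝓝 (a d)) := by
  intro d hd
  obtain ⟨m, rfl⟩ : ∃ m, d = m + 2 := ⟨d - 2, by lia⟩
  have hm1 : m + 2 - 1 = m + 1 := by lia
  have hm2 : m + 2 - 2 = m := by lia
  rw [hm1, hm2]
  obtain ⟨C, hC0, hC⟩ := exists_abs_error_le ha1 har m
  have hN' (k : ℕ) : N (m + 2) k = (weightedSphere (m + 2) k).ncard := hN _ _
  have hbound (k : ℕ) (hk : 1 ≤ k) :
      |(N (m + 2) k : ℝ) - a (m + 2) * (k : ℝ) ^ (m + 1)| ≤ C * 2 ^ m * (k : ℝ) ^ m := by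
    have hk' : (1 : ℝ) ≤ k := by exact_mod_cast hk
    rw [hN', mul_assoc, ← mul_pow]
    refine (hC k).trans ?_
    gcongr
    linarith
  refine ⟨⟨C * 2 ^ m, by positivity, hbound⟩, ?_⟩
  rw [tendsto_iff_norm_sub_tendsto_zero]
  refine squeeze_zero' (Eventually.of_forall fun _ => norm_nonneg _) ?_
    (tendsto_const_div_atTop_nhds_zero_nat (C * 2 ^ m))
  filter_upwards [eventually_ge_atTop 1] with k hk
  have hk' : (0 : ℝ) < k := by exact_mod_cast hk
  have heq : (N (m + 2) k : ℝ) / (k : ℝ) ^ (m + 1) - a (m + 2) =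
      ((N (m + 2) k : ℝ) - a (m + 2) * (k : ℝ) ^ (m + 1)) / (k : ℝ) ^ (m + 1) := by
    field_simp
  rw [heq, Real.norm_eq_abs, abs_div, abs_of_pos (pow_pos hk' (m + 1)),
    div_le_div_iff₀ (by positivity) hk']
  calc _ ≤ C * 2 ^ m * (k : ℝ) ^ m * k := mul_le_mul_of_nonneg_right (hbound k hk) hk'.le
    _ = C * 2 ^ m * (k : ℝ) ^ (m + 1) := by ring
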